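/- Let F := (z₂ − 2)² − (z₁ − 1)(z₁⁵ + 2z₁ + 5)² ∈ ℂ[z₁,z₂]. For generic u ∈ ℂ², the set {z ∈ (ℂ*)² : F(z) = 0 and there exists λ ∈ ℂ with u_i = λ·z_i·(∂F/∂z_i)(z) for i = 1,2} has exactly 12 elements. (The ML degree of the hyperelliptic curve (y−2)² = (x−1)(x⁵+2x+5)² is 12, i.e., r₀ = 12.) -/

import Mathlib

open MvPolynomial

/-- The hyperelliptic curve `(y − 2)² = (x − 1)(x⁵ + 2x + 5)²`. -/
noncomputable def hyperF : MvPolynomial (Fin 2) ℂ :=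
  (X 1 - 2) ^ 2 - (X 0 - 1) * (X 0 ^ 5 + 2 * X 0 + 5) ^ 2

/-! The curve is rational, parametrized by `t ↦ (1 + t², P(t))` with `P = 2 + t·q(1 + t²)` and
`q(x) = x⁵ + 2x + 5`. In this parameter the critical equation is `u₀·2t·P + u₁·(1 + t²)·∂P = 0`,
a member of a pencil of polynomials of degree `12`. -/

/-- A member of the pencil spanned by `A` and `B` is separable if it does not vanish at any root
of the Wronskian of `A` and `B`. -/
lemma separable_pencil {A B : Polynomial ℂ} {a b : ℂ} (ha : a ≠ 0)
    (h : ∀ t, (Polynomial.wronskian A B).eval t = 0 → a * A.eval t + b * B.eval t ≠ 0) :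
    (Polynomial.C a * A + Polynomial.C b * B).Separable := by
  rw [Polynomial.separable_def,
    Polynomial.isCoprime_iff_aeval_ne_zero_of_isAlgClosed ℂ ℂ]
  intro t
  by_contra! hc
  obtain ⟨h0, h1⟩ := hc
  simp only [Polynomial.coe_aeval_eq_eval, Polynomial.derivative_add,
    Polynomial.derivative_C_mul, Polynomial.eval_add, Polynomial.eval_mul,
    Polynomial.eval_C] at h0 h1
  refine h t ?_ h0
  have hW : a * (Polynomial.wronskian A B).eval t = 0 := by
    simp only [Polynomial.wronskian, Polynomial.eval_sub, Polynomial.eval_mul]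
    linear_combination (Polynomial.derivative B).eval t * h0 - B.eval t * h1
  exact (mul_eq_zero.mp hW).resolve_left ha

/-- If `A` and `B` have no common root, then a generic member of their pencil avoids the roots of
a given nonzero polynomial. -/
lemma exists_generic_pencil_ne_zero {A B W : Polynomial ℂ} (hW : W ≠ 0)
    (hAB : ∀ t, A.eval t = 0 → B.eval t ≠ 0) :
    ∃ g : MvPolynomial (Fin 2) ℂ, g ≠ 0 ∧ ∀ u : Fin 2 → ℂ, eval u g ≠ 0 →
      ∀ t, W.eval t = 0 → u 0 * A.eval t + u 1 * B.eval t ≠ 0 := by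
  refine ⟨∏ t ∈ W.roots.toFinset, (X 0 * C (A.eval t) + X 1 * C (B.eval t)), ?_, ?_⟩
  · refine Finset.prod_ne_zero_iff.mpr fun t _ h => ?_
    have h0 := congrArg (eval ![1, 0]) h
    have h1 := congrArg (eval ![0, 1]) h
    simp at h0 h1
    exact hAB t h0 h1
  · intro u hu t ht
    rw [eval_prod, Finset.prod_ne_zero_iff] at hu
    simpa using hu t (by simpa [hW] using ht)

/-- The second coordinate of the parametrization of the curve. -/
noncomputable def paramY : Polynomial ℂ :=
  2 + Polynomial.X * ((1 + Polynomial.X ^ 2) ^ 5 + 2 * (1 + Polynomial.X ^ 2) + 5)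

lemma eval_paramY (t : ℂ) :
    paramY.eval t = 2 + t * ((1 + t ^ 2) ^ 5 + 2 * (1 + t ^ 2) + 5) := by
  simp [paramY]

lemma eval_derivative_paramY (t : ℂ) :
    (Polynomial.derivative paramY).eval t =
      11 * t ^ 10 + 45 * t ^ 8 + 70 * t ^ 6 + 50 * t ^ 4 + 21 * t ^ 2 + 8 := by
  simp [paramY, Polynomial.derivative_pow]
  ring

/-- The coefficient of `u₀` in the critical equation. -/
noncomputable def pencilA : Polynomial ℂ := 2 * Polynomial.X * paramY

/-- The coefficient of `u₁` in the critical equation. -/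
noncomputable def pencilB : Polynomial ℂ :=
  (1 + Polynomial.X ^ 2) * Polynomial.derivative paramY

lemma eval_pencilA (t : ℂ) : pencilA.eval t = 2 * t * paramY.eval t := by
  simp [pencilA]

lemma eval_pencilB (t : ℂ) :
    pencilB.eval t = (1 + t ^ 2) * (Polynomial.derivative paramY).eval t := by
  simp [pencilB]

lemma pencilA_eq : pencilA = 2 * Polynomial.X ^ 12 + 10 * Polynomial.X ^ 10 +
    20 * Polynomial.X ^ 8 + 20 * Polynomial.X ^ 6 + 14 * Polynomial.X ^ 4 +
    16 * Polynomial.X ^ 2 + 4 * Polynomial.X := by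
  refine Polynomial.funext fun t => ?_
  simp only [eval_pencilA, eval_paramY, Polynomial.eval_add, Polynomial.eval_mul,
    Polynomial.eval_pow, Polynomial.eval_X, Polynomial.eval_ofNat]
  ring

lemma pencilB_eq : pencilB = 11 * Polynomial.X ^ 12 + 56 * Polynomial.X ^ 10 +
    115 * Polynomial.X ^ 8 + 120 * Polynomial.X ^ 6 + 71 * Polynomial.X ^ 4 +
    29 * Polynomial.X ^ 2 + 8 := by
  refine Polynomial.funext fun t => ?_
  simp only [eval_pencilB, eval_derivative_paramY, Polynomial.eval_add, Polynomial.eval_mul,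
    Polynomial.eval_pow, Polynomial.eval_X, Polynomial.eval_ofNat]
  ring

lemma natDegree_pencil {a b : ℂ} (h : 2 * a + 11 * b ≠ 0) :
    (Polynomial.C a * pencilA + Polynomial.C b * pencilB).natDegree = 12 := by
  rw [pencilA_eq, pencilB_eq]
  compute_degree
  · intro h0
    apply h
    linear_combination h0
  all_goals norm_num

lemma paramY_eval_ne_zero_of_one_add_sq {t : ℂ} (h : 1 + t ^ 2 = 0) : paramY.eval t ≠ 0 := by
  intro hP
  rw [eval_paramY, h] at hP
  have : (29 : ℂ) = 0 := by linear_combination 25 * h - (5 * t - 2) * hP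
  norm_num at this

/-- `paramY` has no multiple root: an explicit Bézout certificate in `x = 1 + t²` for
`(x - 1) q² - 4` and `q + 2 (x - 1) ∂q`. -/
lemma derivative_paramY_eval_ne_zero {t : ℂ} (h : paramY.eval t = 0) :
    (Polynomial.derivative paramY).eval t ≠ 0 := by
  intro h'
  rw [eval_paramY] at h
  rw [eval_derivative_paramY] at h'
  obtain ⟨x, hx⟩ : ∃ x, x = 1 + t ^ 2 := ⟨_, rfl⟩
  have hr : 11 * x ^ 5 - 10 * x ^ 4 + 6 * x + 1 = 0 := by
    rw [hx]
    linear_combination h'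
  have hs : (x - 1) * (x ^ 5 + 2 * x + 5) ^ 2 - 4 = 0 := by
    rw [hx]
    linear_combination (t * ((1 + t ^ 2) ^ 5 + 2 * (1 + t ^ 2) + 5) - 2) * h
  have : (15867927142737316 : ℂ) = 0 := by
    linear_combination
      (-538565497050163 - 20536033207282 * x - 171109361104164 * x ^ 2
        - 78974383107485 * x ^ 3 - 171789314943499 * x ^ 4) * hs
      + (249527728282589 + 600116152544103 * x + 156859731553644 * x ^ 2
        + 106969825599055 * x ^ 3 + 86334021903266 * x ^ 4 + 159671561265236 * x ^ 5
        + 99849491713973 * x ^ 6 - 1313905206672 * x ^ 7 + 13612037062349 * x ^ 8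
        + 5759742968916 * x ^ 9 + 15617210449409 * x ^ 10) * hr
  norm_num at this

lemma pencilB_eval_ne_zero {t : ℂ} (h : pencilA.eval t = 0) : pencilB.eval t ≠ 0 := by
  rw [eval_pencilA] at h
  rw [eval_pencilB]
  rcases mul_eq_zero.mp h with h0 | hP
  · have ht : t = 0 := by simpa using h0
    rw [eval_derivative_paramY, ht]
    norm_num
  · exact mul_ne_zero (fun h1 => paramY_eval_ne_zero_of_one_add_sq h1 hP)
      (derivative_paramY_eval_ne_zero hP)

lemma wronskian_pencil_ne_zero : Polynomial.wronskian pencilA pencilB ≠ 0 := by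
  intro h
  have h0 := congrArg (Polynomial.eval 0) h
  simp [pencilA_eq, pencilB_eq, Polynomial.wronskian] at h0

/-- The polynomial cutting out the parameters that map to the singular points of the curve. -/
noncomputable def nodePoly : Polynomial ℂ :=
  (1 + Polynomial.X ^ 2) ^ 5 + 2 * (1 + Polynomial.X ^ 2) + 5

lemma eval_nodePoly (t : ℂ) :
    nodePoly.eval t = (1 + t ^ 2) ^ 5 + 2 * (1 + t ^ 2) + 5 := by
  simp [nodePoly]

lemma nodePoly_ne_zero : nodePoly ≠ 0 := by
  intro h
  have h0 := congrArg (Polynomial.eval 0) h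
  rw [eval_nodePoly] at h0
  norm_num at h0

lemma eval_hyperF (z : Fin 2 → ℂ) :
    eval z hyperF = (z 1 - 2) ^ 2 - (z 0 - 1) * (z 0 ^ 5 + 2 * z 0 + 5) ^ 2 := by
  simp [hyperF]

lemma eval_pderiv_zero_hyperF (z : Fin 2 → ℂ) :
    eval z (pderiv 0 hyperF) =
      -(z 0 ^ 5 + 2 * z 0 + 5) * (11 * z 0 ^ 5 - 10 * z 0 ^ 4 + 6 * z 0 + 1) := by
  have h2 : pderiv (0 : Fin 2) (2 : MvPolynomial (Fin 2) ℂ) = 0 := pderiv_C (a := 2)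
  have h5 : pderiv (0 : Fin 2) (5 : MvPolynomial (Fin 2) ℂ) = 0 := pderiv_C (a := 5)
  simp [hyperF, pderiv_X, h2, h5]
  ring

lemma eval_pderiv_one_hyperF (z : Fin 2 → ℂ) :
    eval z (pderiv 1 hyperF) = 2 * (z 1 - 2) := by
  have h2 : pderiv (1 : Fin 2) (2 : MvPolynomial (Fin 2) ℂ) = 0 := pderiv_C (a := 2)
  have h5 : pderiv (1 : Fin 2) (5 : MvPolynomial (Fin 2) ℂ) = 0 := pderiv_C (a := 5)
  simp [hyperF, pderiv_X, h2, h5]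

/-- The critical points are the images of the roots of the critical equation. -/
lemma criticalSet_eq_image {u : Fin 2 → ℂ} (hu0 : u 0 ≠ 0) (hu1 : u 1 ≠ 0)
    (hnode : ∀ t, nodePoly.eval t = 0 → u 0 * pencilA.eval t + u 1 * pencilB.eval t ≠ 0) :
    {z : Fin 2 → ℂ | (∀ i, z i ≠ 0) ∧ eval z hyperF = 0 ∧
      ∃ lam : ℂ, ∀ i, u i = lam * z i * eval z (pderiv i hyperF)} =
    Set.image (fun t : ℂ => ![1 + t ^ 2, paramY.eval t])
      {t | u 0 * pencilA.eval t + u 1 * pencilB.eval t = 0} := by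
  ext z
  simp only [Set.mem_ofPred_eq, Set.mem_image, Fin.forall_fin_two, eval_hyperF,
    eval_pderiv_zero_hyperF, eval_pderiv_one_hyperF]
  constructor
  · rintro ⟨-, hF, lam, h0, h1⟩
    have hq : z 0 ^ 5 + 2 * z 0 + 5 ≠ 0 := by
      intro hq
      apply hu0
      rw [h0, hq]
      ring
    obtain ⟨t, ht⟩ : ∃ t, z 1 - 2 = t * (z 0 ^ 5 + 2 * z 0 + 5) :=
      ⟨_, (div_mul_cancel₀ _ hq).symm⟩
    have hz0 : z 0 = 1 + t ^ 2 := by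
      have : (z 0 ^ 5 + 2 * z 0 + 5) ^ 2 * (z 0 - (1 + t ^ 2)) = 0 := by
        rw [ht] at hF
        linear_combination -hF
      exact sub_eq_zero.mp ((mul_eq_zero.mp this).resolve_left (pow_ne_zero 2 hq))
    have hz1 : z 1 = paramY.eval t := by
      rw [eval_paramY, ← hz0]
      linear_combination ht
    refine ⟨t, ?_, ?_⟩
    · rw [eval_pencilA, eval_pencilB, eval_derivative_paramY, ← hz1, ← hz0, h0, h1, ht, hz0]
      ring
    · ext i
      fin_cases i
      · simp [hz0]
      · simp [hz1]
  · rintro ⟨t, ht, rfl⟩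
    have hq : (1 + t ^ 2) ^ 5 + 2 * (1 + t ^ 2) + 5 ≠ 0 := fun h =>
      hnode t (by rw [eval_nodePoly, h]) ht
    have hx : 1 + t ^ 2 ≠ 0 := by
      intro h
      have hA : pencilA.eval t = 0 := by
        simpa [eval_pencilB, h, hu0] using ht
      exact pencilB_eval_ne_zero hA (by simp [eval_pencilB, h])
    have hy : paramY.eval t ≠ 0 := by
      intro h
      have hA : pencilA.eval t = 0 := by simp [eval_pencilA, h]
      exact pencilB_eval_ne_zero hA (by simpa [hA, hu1] using ht)
    have ht0 : t ≠ 0 := by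
      intro h
      have hA : pencilA.eval t = 0 := by simp [eval_pencilA, h]
      exact pencilB_eval_ne_zero hA (by simpa [hA, hu1] using ht)
    simp only [Matrix.cons_val_zero, Matrix.cons_val_one]
    refine ⟨⟨hx, hy⟩, ?_, u 1 / (paramY.eval t * (2 *
      (t * ((1 + t ^ 2) ^ 5 + 2 * (1 + t ^ 2) + 5)))), ?_, ?_⟩
    · rw [eval_paramY]
      ring
    · rw [div_mul_eq_mul_div, div_mul_eq_mul_div, eq_div_iff
        (mul_ne_zero hy (mul_ne_zero two_ne_zero (mul_ne_zero ht0 hq)))]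
      rw [eval_pencilA, eval_pencilB, eval_derivative_paramY] at ht
      linear_combination ((1 + t ^ 2) ^ 5 + 2 * (1 + t ^ 2) + 5) * ht
    · have hd : paramY.eval t - 2 = t * ((1 + t ^ 2) ^ 5 + 2 * (1 + t ^ 2) + 5) := by
        rw [eval_paramY]
        ring
      rw [hd, mul_assoc, div_mul_cancel₀ _
        (mul_ne_zero hy (mul_ne_zero two_ne_zero (mul_ne_zero ht0 hq)))]

/-- The parametrization is injective away from the preimages of the singular points. -/
lemma injOn_param : Set.InjOn (fun t : ℂ => ![1 + t ^ 2, paramY.eval t])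
    {t | nodePoly.eval t ≠ 0} := by
  intro s hs t _ hst
  have hx : 1 + s ^ 2 = 1 + t ^ 2 := by simpa using congrFun hst 0
  have hy : paramY.eval s = paramY.eval t := by simpa using congrFun hst 1
  rw [Set.mem_ofPred_eq, eval_nodePoly] at hs
  rw [eval_paramY, eval_paramY, ← hx] at hy
  exact mul_right_cancel₀ hs (add_left_cancel hy)

/-- **The ML degree of the hyperelliptic curve `(y−2)² = (x−1)(x⁵+2x+5)²` is `r₀ = 12`**:
for generic `u ∈ ℂ²` there are exactly `12` ML-critical points on the torus. -/
theorem hyperelliptic_ml_degree :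
    ∃ g : MvPolynomial (Fin 2) ℂ, g ≠ 0 ∧
      ∀ u : Fin 2 → ℂ, eval u g ≠ 0 →
        {z : Fin 2 → ℂ | (∀ i, z i ≠ 0) ∧ eval z hyperF = 0 ∧
            ∃ lam : ℂ, ∀ i, u i = lam * z i * eval z (pderiv i hyperF)}.ncard = 12 := by
  obtain ⟨g, hg, hgu⟩ := exists_generic_pencil_ne_zero
    (mul_ne_zero wronskian_pencil_ne_zero nodePoly_ne_zero) fun _ => pencilB_eval_ne_zero
  have hlin : (2 * X 0 + 11 * X 1 : MvPolynomial (Fin 2) ℂ) ≠ 0 := by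
    intro h
    have h0 := congrArg (eval ![1, 0]) h
    simp at h0
  refine ⟨X 0 * X 1 * (2 * X 0 + 11 * X 1) * g,
    mul_ne_zero (mul_ne_zero (mul_ne_zero (X_ne_zero 0) (X_ne_zero 1)) hlin) hg, fun u hu => ?_⟩
  simp only [map_mul, map_add, eval_X, map_ofNat, mul_ne_zero_iff] at hu
  obtain ⟨⟨⟨hu0, hu1⟩, hdeg⟩, hu⟩ := hu
  have hW : ∀ t, (Polynomial.wronskian pencilA pencilB).eval t = 0 →
      u 0 * pencilA.eval t + u 1 * pencilB.eval t ≠ 0 := fun t h =>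
    hgu u hu t (by rw [Polynomial.eval_mul, h, zero_mul])
  have hnode : ∀ t, nodePoly.eval t = 0 →
      u 0 * pencilA.eval t + u 1 * pencilB.eval t ≠ 0 := fun t h =>
    hgu u hu t (by rw [Polynomial.eval_mul, h, mul_zero])
  have hsub : {t | u 0 * pencilA.eval t + u 1 * pencilB.eval t = 0} ⊆
      {t | nodePoly.eval t ≠ 0} := fun t ht hn => hnode t hn ht
  rw [criticalSet_eq_image hu0 hu1 hnode, (injOn_param.mono hsub).ncard_image]
  have hsep := separable_pencil hu0 hW
  have hroots : {t | u 0 * pencilA.eval t + u 1 * pencilB.eval t = 0} =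
      ((Polynomial.C (u 0) * pencilA + Polynomial.C (u 1) * pencilB).roots.toFinset : Set ℂ) := by
    ext t
    simp [Polynomial.mem_roots', hsep.ne_zero]
  rw [hroots, Set.ncard_coe_finset,
    Multiset.toFinset_card_of_nodup (Polynomial.nodup_roots hsep),
    ← (IsAlgClosed.splits _).natDegree_eq_card_roots, natDegree_pencil hdeg]
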